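/- Consider the system (DS⁺): x' = x(x+1) − M₊(λ(N−1)x − z), z' = z(x+2+a−px). (a) If λ < Λ and either 1 < p ≤ p_Δ^a = (N+2+2a)/(N−2) or p > p^{p,a}₊ = (Ñ₊+2a+2)/(Ñ₊−2), then every periodic C¹ solution (x,z) : ℝ → ℝ² of (DS⁺) whose image is contained in the open first quadrant {x > 0, z > 0} is constant. (b) For every p > 1, every periodic C¹ solution of (DS⁺) whose image is contained in the set {(x,z) : x > 0, z ≥ λ(N−1)x} is constant, i.e., there are no periodic orbits strictly contained in the closed concavity region R⁺_λ ∪ ℓ₊. -/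

import Mathlib

open Real Set

noncomputable def Mplus (lam Lam s : ℝ) : ℝ := if s ≤ 0 then s / lam else s / Lam

/-- A monotone periodic function is constant. -/
lemma Monotone.eq_of_periodic {f : ℝ → ℝ} {T : ℝ} (hf : Monotone f)
    (hT : 0 < T) (hper : Function.Periodic f T) (s t : ℝ) : f s = f t := by
  obtain ⟨y, hy, hsy⟩ := hper.exists_mem_Ico hT s t
  rw [hsy]
  exact le_antisymm ((hf hy.2.le).trans_eq (hper t)) (hf hy.1)

/-- If a periodic function has a derivative of constant sign, the derivative vanishes. -/
lemma deriv_eq_zero_of_periodic {f f' : ℝ → ℝ} {T : ℝ} (hT : 0 < T)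
    (hper : Function.Periodic f T) (hf : ∀ t, HasDerivAt f (f' t) t)
    (hsign : (∀ t, 0 ≤ f' t) ∨ ∀ t, f' t ≤ 0) (t : ℝ) : f' t = 0 := by
  have hconst : ∀ s, f s = f t := by
    intro s
    rcases hsign with h | h
    · exact (monotone_of_hasDerivAt_nonneg hf h).eq_of_periodic hT hper s t
    · have hm : Monotone (-f) :=
        monotone_of_hasDerivAt_nonneg (fun u => (hf u).neg) (fun u => neg_nonneg.2 (h u))
      have hp : Function.Periodic (-f) T := fun u => congrArg Neg.neg (hper u)
      exact neg_injective (hm.eq_of_periodic hT hp s t)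
  have hfc : f = fun _ => f t := funext hconst
  have h0 : HasDerivAt f 0 t := by
    rw [hfc]
    exact hasDerivAt_const t _
  exact (hf t).unique h0

/-- A periodic function whose derivative is nonzero wherever it differs from `c` equals `c`. -/
lemma eq_const_of_periodic {f f' : ℝ → ℝ} {T c : ℝ} (hT : 0 < T)
    (hper : Function.Periodic f T) (hf : ∀ t, HasDerivAt f (f' t) t)
    (h : ∀ t, f t = c ∨ f' t ≠ 0) (t : ℝ) : f t = c := by
  have hcont : ContinuousOn f (Icc 0 T) := fun t _ => (hf t).continuousAt.continuousWithinAt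
  have hne : (Icc 0 T).Nonempty := nonempty_Icc.2 hT.le
  obtain ⟨u, -, hu⟩ := isCompact_Icc.exists_isMaxOn hne hcont
  obtain ⟨l, -, hl⟩ := isCompact_Icc.exists_isMinOn hne hcont
  have hu' : ∀ s, f s ≤ f u := fun s => by
    obtain ⟨y, hy, hsy⟩ := hper.exists_mem_Ico₀ hT s
    exact hsy.trans_le (hu (Ico_subset_Icc_self hy))
  have hl' : ∀ s, f l ≤ f s := fun s => by
    obtain ⟨y, hy, hsy⟩ := hper.exists_mem_Ico₀ hT s
    exact (hl (Ico_subset_Icc_self hy) : f l ≤ f y).trans_eq hsy.symm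
  have hmax : IsLocalMax f u := Filter.Eventually.of_forall hu'
  have hmin : IsLocalMin f l := Filter.Eventually.of_forall hl'
  have huc : f u = c := (h u).resolve_right (not_not.2 (hmax.hasDerivAt_eq_zero (hf u)))
  have hlc : f l = c := (h l).resolve_right (not_not.2 (hmin.hasDerivAt_eq_zero (hf l)))
  exact le_antisymm ((hu' t).trans_eq huc) (hlc.symm.trans_le (hl' t))

lemma Mplus_of_nonpos {lam Lam s : ℝ} (h : s ≤ 0) : Mplus lam Lam s = s / lam := if_pos h

lemma Mplus_of_pos {lam Lam s : ℝ} (h : 0 < s) : Mplus lam Lam s = s / Lam :=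
  if_neg (not_le.2 h)

lemma continuous_Mplus (lam Lam : ℝ) : Continuous (Mplus lam Lam) := by
  unfold Mplus
  refine Continuous.if_le (by fun_prop) (by fun_prop) continuous_id continuous_const ?_
  rintro s rfl
  simp

lemma Mplus_sub_mul_le {lam Lam : ℝ} (hlam : 0 < lam) (hlL : lam ≤ Lam) (s r : ℝ) :
    (s - r) * (Mplus lam Lam s - Mplus lam Lam r) ≤ (s - r) ^ 2 / lam := by
  have hinv : Lam⁻¹ ≤ lam⁻¹ := inv_anti₀ hlam hlL
  rcases le_or_gt s 0 with hs | hs <;> rcases le_or_gt r 0 with hr | hr <;>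
    simp only [Mplus_of_nonpos, Mplus_of_pos, hs, hr, div_eq_mul_inv]
  · nlinarith
  · nlinarith [mul_nonneg (mul_nonneg (sub_nonneg.2 (hs.trans hr.le)) hr.le) (sub_nonneg.2 hinv)]
  · nlinarith [mul_nonneg (mul_nonneg (sub_nonneg.2 (hr.trans hs.le)) hs.le) (sub_nonneg.2 hinv)]
  · nlinarith [mul_nonneg (sq_nonneg (s - r)) (sub_nonneg.2 hinv)]

lemma Mplus_sub_mul_lt {lam Lam s r : ℝ} (hlam : 0 < lam) (hlL : lam < Lam) (hs : 0 < s)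
    (hsr : s ≠ r) :
    (s - r) * (Mplus lam Lam s - Mplus lam Lam r) < (s - r) ^ 2 / lam := by
  have hinv : Lam⁻¹ < lam⁻¹ := inv_strictAnti₀ hlam hlL
  rcases le_or_gt r 0 with hr | hr <;>
    simp only [Mplus_of_nonpos, Mplus_of_pos, hs, hr, div_eq_mul_inv]
  · nlinarith [mul_pos (mul_pos (sub_pos.2 (hr.trans_lt hs)) hs) (sub_pos.2 hinv)]
  · nlinarith [mul_pos (sq_pos_of_ne_zero (sub_ne_zero.2 hsr)) (sub_pos.2 hinv)]

lemma le_Mplus_sub_mul {lam Lam : ℝ} (hlam : 0 < lam) (hlL : lam ≤ Lam) (s r : ℝ) :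
    (s - r) ^ 2 / Lam ≤ (s - r) * (Mplus lam Lam s - Mplus lam Lam r) := by
  have hinv : Lam⁻¹ ≤ lam⁻¹ := inv_anti₀ hlam hlL
  rcases le_or_gt s 0 with hs | hs <;> rcases le_or_gt r 0 with hr | hr <;>
    simp only [Mplus_of_nonpos, Mplus_of_pos, hs, hr, div_eq_mul_inv]
  · nlinarith [mul_nonneg (sq_nonneg (s - r)) (sub_nonneg.2 hinv)]
  · nlinarith [mul_nonneg (mul_nonneg (sub_nonneg.2 (hs.trans hr.le)) (neg_nonneg.2 hs))
      (sub_nonneg.2 hinv)]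
  · nlinarith [mul_nonneg (mul_nonneg (sub_nonneg.2 (hr.trans hs.le)) (neg_nonneg.2 hr))
      (sub_nonneg.2 hinv)]
  · nlinarith

/-- In the closed concavity region the first component is strictly increasing. -/
lemma field_fst_pos {lam Lam κ x z : ℝ} (hlam : 0 < lam) (hx : 0 < x) (hz : κ * x ≤ z) :
    0 < x * (x + 1) - Mplus lam Lam (κ * x - z) := by
  rw [Mplus_of_nonpos (by linarith)]
  have : (κ * x - z) / lam ≤ 0 := div_nonpos_of_nonpos_of_nonneg (by linarith) hlam.le
  nlinarith

/-- With `k = p - 1` and `k * c = 2 + a`, the system has the energy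
`z ^ (2 / k) * (x - c) ^ 2 / 2 + V (log z)`, where the potential `V` comes from the force
on the line `x = c`. -/
lemma exists_energy (M : ℝ → ℝ) (hM : Continuous M) {κ k c : ℝ} (hk : 0 < k)
    {x z : ℝ → ℝ}
    (hx : ∀ t, HasDerivAt x (x t * (x t + 1) - M (κ * x t - z t)) t)
    (hz : ∀ t, HasDerivAt z (z t * (k * (c - x t))) t) (hzpos : ∀ t, 0 < z t) :
    ∃ E : ℝ × ℝ → ℝ, ∀ t, HasDerivAt (fun t => E (x t, z t))
      (Real.exp (2 / k * Real.log (z t)) * ((2 * c + 1) * (x t - c) ^ 2 -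
        (x t - c) * (M (κ * x t - z t) - M (κ * c - z t)))) t := by
  let g : ℝ → ℝ := fun y => Real.exp (2 / k * y) * (c ^ 2 + c - M (κ * c - Real.exp y)) / k
  have hg : Continuous g := by fun_prop
  refine ⟨fun q => Real.exp (2 / k * Real.log q.2) * (q.1 - c) ^ 2 / 2 +
    ∫ y in (0 : ℝ)..Real.log q.2, g y, fun t => ?_⟩
  have hy : HasDerivAt (fun t => Real.log (z t)) (k * (c - x t)) t := by
    convert (hz t).log (hzpos t).ne' using 1
    field_simp [(hzpos t).ne']
  have hV : HasDerivAt (fun t => ∫ y in (0 : ℝ)..Real.log (z t), g y)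
      (g (Real.log (z t)) * (k * (c - x t))) t :=
    HasDerivAt.comp (h₂ := fun u => ∫ y in (0 : ℝ)..u, g y) t
      (hg.integral_hasStrictDerivAt 0 (Real.log (z t))).hasDerivAt hy
  have hK := (((hy.const_mul (2 / k)).exp.mul (((hx t).sub_const c).pow 2)).div_const 2).add hV
  refine hK.congr_deriv ?_
  simp only [g, Real.exp_log (hzpos t), Pi.pow_apply]
  field_simp
  norm_num
  ring

/-- Dulac-type criterion for (DS⁺): (a) if `λ < Λ` and `1 < p ≤ p_Δ^a` or
`p > p^{p,a}₊`, every periodic orbit in the open first quadrant is constant;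
(b) for every `p > 1`, every periodic orbit contained in the closed concavity
region `{x > 0, z ≥ λ(N-1)x}` is constant. -/
theorem no_periodic_orbits
    (N : ℕ) (hN : 3 ≤ N) (lam Lam : ℝ) (hlam : 0 < lam) (hlL : lam ≤ Lam)
    (p a : ℝ) (hp : 1 < p) (ha : -1 < a)
    (Nt : ℝ) (hNtdef : Nt = lam / Lam * ((N : ℝ) - 1) + 1) (hNt : 2 < Nt) :
    ((lam < Lam →
      (p ≤ ((N : ℝ) + 2 + 2 * a) / ((N : ℝ) - 2) ∨
        (Nt + 2 * a + 2) / (Nt - 2) < p) →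
      ∀ x z : ℝ → ℝ,
        (∀ t : ℝ, HasDerivAt x
          (x t * (x t + 1) - Mplus lam Lam (lam * ((N : ℝ) - 1) * x t - z t)) t) →
        (∀ t : ℝ, HasDerivAt z (z t * (x t + 2 + a - p * x t)) t) →
        (∀ t : ℝ, 0 < x t ∧ 0 < z t) →
        (∃ T : ℝ, 0 < T ∧ ∀ t : ℝ, x (t + T) = x t ∧ z (t + T) = z t) →
        ∀ s t : ℝ, x s = x t ∧ z s = z t)) ∧
    (∀ x z : ℝ → ℝ,
      (∀ t : ℝ, HasDerivAt x
        (x t * (x t + 1) - Mplus lam Lam (lam * ((N : ℝ) - 1) * x t - z t)) t) →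
      (∀ t : ℝ, HasDerivAt z (z t * (x t + 2 + a - p * x t)) t) →
      (∀ t : ℝ, 0 < x t ∧ lam * ((N : ℝ) - 1) * x t ≤ z t) →
      (∃ T : ℝ, 0 < T ∧ ∀ t : ℝ, x (t + T) = x t ∧ z (t + T) = z t) →
      ∀ s t : ℝ, x s = x t ∧ z s = z t) := by
  have hN' : (3 : ℝ) ≤ N := by exact_mod_cast hN
  have hLam : 0 < Lam := hlam.trans_le hlL
  have hk : 0 < p - 1 := by linarith
  constructor
  · rintro hlt hcase x z hx hz hpos ⟨T, hT, hper⟩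
    have hxper : Function.Periodic x T := fun t => (hper t).1
    set κ := lam * ((N : ℝ) - 1) with hκ
    have hκpos : 0 < κ := mul_pos hlam (by linarith)
    have hκlam : κ / lam = N - 1 := by rw [hκ]; field_simp
    have hκLam : κ / Lam = Nt - 1 := by rw [hκ, hNtdef]; ring
    obtain ⟨c, hc⟩ : ∃ c, (p - 1) * c = 2 + a := ⟨(2 + a) / (p - 1), by field_simp⟩
    have hz' : ∀ t, HasDerivAt z (z t * ((p - 1) * (c - x t))) t := fun t => by
      convert hz t using 2
      rw [mul_sub, hc]
      ring
    obtain ⟨E, hE⟩ := exists_energy (Mplus lam Lam) (continuous_Mplus lam Lam) hk hx hz'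
      fun t => (hpos t).2
    have hEper : Function.Periodic (fun t => E (x t, z t)) T := fun t => by
      simp only [(hper t).1, (hper t).2]
    have hup : ∀ t, (x t - c) * (Mplus lam Lam (κ * x t - z t) - Mplus lam Lam (κ * c - z t)) ≤
        (N - 1) * (x t - c) ^ 2 := fun t => by
      have := Mplus_sub_mul_le hlam hlL (κ * x t - z t) (κ * c - z t)
      refine le_of_mul_le_mul_left ?_ hκpos
      calc _ = _ := by ring
        _ ≤ _ := this
        _ = _ := by rw [← hκlam]; ring
    have hlow : ∀ t, (Nt - 1) * (x t - c) ^ 2 ≤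
        (x t - c) * (Mplus lam Lam (κ * x t - z t) - Mplus lam Lam (κ * c - z t)) := fun t => by
      have := le_Mplus_sub_mul hlam hlL (κ * x t - z t) (κ * c - z t)
      refine le_of_mul_le_mul_left ?_ hκpos
      calc _ = _ := by rw [← hκLam]; ring
        _ ≤ _ := this
        _ = _ := by ring
    have hcase' : (N : ℝ) - 1 ≤ 2 * c + 1 ∨ 2 * c + 1 < Nt - 1 := by
      refine hcase.imp (fun h => ?_) (fun h => ?_)
      · rw [le_div_iff₀ (by linarith)] at h
        refine le_of_mul_le_mul_left ?_ hk
        linarith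
      · rw [div_lt_iff₀ (by linarith)] at h
        refine lt_of_mul_lt_mul_left ?_ hk.le
        linarith
    have hD := deriv_eq_zero_of_periodic hT hEper hE <| hcase'.imp
      (fun h t => mul_nonneg (Real.exp_pos _).le (by
        nlinarith [hup t, mul_nonneg (sub_nonneg.2 h) (sq_nonneg (x t - c))]))
      (fun h t => mul_nonpos_of_nonneg_of_nonpos (Real.exp_pos _).le (by
        nlinarith [hlow t, mul_nonneg (sub_nonneg.2 h.le) (sq_nonneg (x t - c))]))
    have hxc : ∀ t, x t = c := by
      refine eq_const_of_periodic hT hxper hx fun t => or_iff_not_imp_left.2 fun hne => ?_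
      have hDt := (mul_eq_zero.1 (hD t)).resolve_left (Real.exp_pos _).ne'
      have hw : 0 < (x t - c) ^ 2 := sq_pos_of_ne_zero (sub_ne_zero.2 hne)
      refine (field_fst_pos hlam (hpos t).1 (not_lt.1 fun hs => ?_)).ne'
      rcases hcase' with h | h
      · have hlt' := Mplus_sub_mul_lt (r := κ * c - z t) hlam hlt (sub_pos.2 hs)
          fun he => hne (mul_left_cancel₀ hκpos.ne' (sub_left_injective he))
        have : (x t - c) * (Mplus lam Lam (κ * x t - z t) - Mplus lam Lam (κ * c - z t)) <
            (N - 1) * (x t - c) ^ 2 := by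
          refine lt_of_mul_lt_mul_left ?_ hκpos.le
          calc _ = _ := by ring
            _ < _ := hlt'
            _ = _ := by rw [← hκlam]; ring
        nlinarith [mul_nonneg (sub_nonneg.2 h) hw.le]
      · nlinarith [hlow t, mul_pos (sub_pos.2 h) hw]
    have hz0 : ∀ t, HasDerivAt z 0 t := fun t => by
      simpa [hxc t] using hz' t
    exact fun s t => ⟨(hxc s).trans (hxc t).symm,
      is_const_of_deriv_eq_zero (fun u => (hz0 u).differentiableAt) (fun u => (hz0 u).deriv) s t⟩
  · rintro x z hx - hpos ⟨T, hT, hper⟩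
    have h := eq_const_of_periodic (c := x 0 - 1) hT (fun t => (hper t).1) hx
      (fun t => Or.inr (field_fst_pos hlam (hpos t).1 (hpos t).2).ne') 0
    linarith
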